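/- Uniform regime for large α: for every α ∈ [α_{n−1}, 1], the constant length vector l(i) = log_D n for all i minimizes the pay-off, i.e., for every l : {1,…,n} → ℝ with l_i ≥ 0 and ∑_{i=1}^n D^{−l_i} ≤ 1, one has α·log_D n + (1−α)·log_D n ≤ α·max_i l_i + (1−α)·∑_i p_i l_i; moreover for α ∈ [α_{n−1}, 1] the weight vector is uniform: w_α(i) = 1/n for every i. -/

import Mathlib

/-- The breakpoints `α_k`: `α_0 = 0` and
`α_{k+1} = α_k + (1−α_k)·(p (n−k−1) − p (n−k)) / ((1/(k+1))·∑_{i=1}^{n−k−1} p i + p (n−k−1))`. -/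
noncomputable def alphaB (n : ℕ) (p : ℕ → ℝ) : ℕ → ℝ
  | 0 => 0
  | k + 1 =>
      alphaB n p k + (1 - alphaB n p k) * (p (n - k - 1) - p (n - k)) /
        ((1 / ((k : ℝ) + 1)) * (∑ i ∈ Finset.Icc 1 (n - k - 1), p i) + p (n - k - 1))

/-- The weight vector on the interval `[α_k, α_{k+1})`:
`w_α(i) = (1−α)·p i` for `1 ≤ i ≤ n−k−1` and
`w_α(i) = (α + (1−α)·∑_{j=n−k}^{n} p j)/(k+1)` for `n−k ≤ i ≤ n`. -/
noncomputable def wgt (n k : ℕ) (p : ℕ → ℝ) (α : ℝ) (i : ℕ) : ℝ :=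
  if i ≤ n - k - 1 then (1 - α) * p i
  else (α + (1 - α) * ∑ j ∈ Finset.Icc (n - k) n, p j) / ((k : ℝ) + 1)


/-- Closed form of the breakpoints: `1 - α_k` is the reciprocal of `k·p (n−k) + ∑_{i ≤ n−k} p i`. -/
theorem one_sub_alphaB_mul (n : ℕ) (p : ℕ → ℝ)
    (hpos : ∀ i, 1 ≤ i → i ≤ n → 0 < p i) (hsum : ∑ i ∈ Finset.Icc 1 n, p i = 1)
    (k : ℕ) (hk : k < n) :
    (1 - alphaB n p k) * (k * p (n - k) + ∑ i ∈ Finset.Icc 1 (n - k), p i) = 1 := by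
  induction k with
  | zero => simp [alphaB, hsum]
  | succ k ih =>
    specialize ih (by omega)
    obtain ⟨m, hm⟩ : ∃ m, n - k = m + 1 := ⟨n - k - 1, by omega⟩
    have hm' : n - (k + 1) = m := by omega
    have hm'' : n - k - 1 = m := by omega
    rw [hm, Finset.sum_Icc_succ_top (by omega)] at ih
    simp only [alphaB]
    rw [hm', hm'', hm]
    have hpm := hpos m (by omega) (by omega)
    have hS : 0 ≤ ∑ i ∈ Finset.Icc 1 m, p i := Finset.sum_nonneg fun i hi =>
      (hpos i (Finset.mem_Icc.mp hi).1 ((Finset.mem_Icc.mp hi).2.trans (by omega))).le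
    generalize ∑ i ∈ Finset.Icc 1 m, p i = S at *
    have hk0 : (0 : ℝ) < k + 1 := by positivity
    have hden : 1 / ((k : ℝ) + 1) * S + p m ≠ 0 := by positivity
    have hprod : ((k + 1 : ℕ) : ℝ) * p m + S = (k + 1) * (1 / ((k : ℝ) + 1) * S + p m) := by
      push_cast
      field_simp
      ring
    have hS' : ((k : ℝ) + 1) * (1 / ((k : ℝ) + 1) * S) = S := by field_simp
    have hcancel := div_mul_cancel₀ ((1 - alphaB n p k) * (p m - p (m + 1))) hden
    rw [hprod]
    linear_combination ih + (1 - alphaB n p k) * hS' - ((k : ℝ) + 1) * hcancel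

/-- Lengths satisfying the Kraft inequality have mean at least the logarithm of their number. -/
theorem card_mul_logb_le_sum_of_kraft {ι : Type*} (s : Finset ι) {b : ℝ} (hb : 1 < b)
    (l : ι → ℝ) (hl : ∑ i ∈ s, b ^ (-(l i)) ≤ 1) :
    s.card * Real.logb b s.card ≤ ∑ i ∈ s, l i := by
  rcases s.eq_empty_or_nonempty with rfl | hs
  · simp
  have hb0 : 0 < b := by linarith
  have hlog : 0 < Real.log b := Real.log_pos hb
  have hc : (0 : ℝ) < s.card := by exact_mod_cast hs.card_pos
  have htangent : ∀ i ∈ s, Real.log s.card - l i * Real.log b ≤ s.card * b ^ (-(l i)) - 1 := by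
    intro i _
    have h := Real.log_le_sub_one_of_pos (mul_pos hc (Real.rpow_pos_of_pos hb0 (-(l i))))
    rw [Real.log_mul hc.ne' (Real.rpow_pos_of_pos hb0 _).ne', Real.log_rpow hb0] at h
    linarith
  have h := Finset.sum_le_sum htangent
  rw [Finset.sum_sub_distrib, Finset.sum_sub_distrib, ← Finset.sum_mul, ← Finset.mul_sum] at h
  simp only [Finset.sum_const, nsmul_eq_mul, mul_one] at h
  rw [Real.logb, ← mul_div_assoc, div_le_iff₀ hlog]
  nlinarith [mul_le_mul_of_nonneg_left hl hc.le]

/-- Uniform regime for large `α`: for every `α ∈ [α_{n−1}, 1]`, the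
constant length vector `l(i) = log_D n` minimizes the pay-off, i.e. for every
nonnegative length vector `l` satisfying the Kraft inequality,
`α·log_D n + (1−α)·log_D n ≤ α·max_i l i + (1−α)·∑ i, p i · l i`; moreover the
weight vector is uniform: `w_α(i) = 1/n` for every `i`. -/
theorem uniform_regime_large_alpha
    (n : ℕ) (hn : 2 ≤ n) (p : ℕ → ℝ)
    (hpos : ∀ i, 1 ≤ i → i ≤ n → 0 < p i)
    (hmono : ∀ i j, 1 ≤ i → i ≤ j → j ≤ n → p j ≤ p i)
    (hsum : ∑ i ∈ Finset.Icc 1 n, p i = 1)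
    (D : ℕ) (hD : 2 ≤ D) (α : ℝ)
    (hα1 : alphaB n p (n - 1) ≤ α) (hα2 : α ≤ 1) :
    (∀ l : ℕ → ℝ, (∀ i, 1 ≤ i → i ≤ n → 0 ≤ l i) →
      (∑ i ∈ Finset.Icc 1 n, (D : ℝ) ^ (-(l i)) ≤ 1) →
      α * Real.logb D n + (1 - α) * Real.logb D n ≤
        α * (Finset.Icc 1 n).sup' (Finset.nonempty_Icc.mpr (by omega)) l +
          (1 - α) * ∑ i ∈ Finset.Icc 1 n, p i * l i) ∧
    (∀ i, 1 ≤ i → i ≤ n → wgt n (n - 1) p α i = 1 / (n : ℝ)) := by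
  have hn0 : (0 : ℝ) < n := by exact_mod_cast (by omega : 0 < n)
  refine ⟨fun l _ hK => ?_, fun i hi _ => ?_⟩
  · have hβ := one_sub_alphaB_mul n p hpos hsum (n - 1) (by omega)
    have h1 : n - (n - 1) = 1 := by omega
    rw [h1, Nat.cast_sub (by omega : 1 ≤ n)] at hβ
    simp only [Nat.cast_one, Finset.Icc_self, Finset.sum_singleton] at hβ
    have hp1 := hpos 1 le_rfl (by omega)
    have hα : (1 - α) * p 1 ≤ 1 / n := by
      rw [le_div_iff₀ hn0]
      nlinarith [mul_le_mul_of_nonneg_right hα1 (mul_pos hn0 hp1).le]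
    set M := (Finset.Icc 1 n).sup' (Finset.nonempty_Icc.mpr (by omega)) l
    have hbound : ∑ i ∈ Finset.Icc 1 n, (1 / (n : ℝ) - (1 - α) * p i) * l i ≤
        ∑ i ∈ Finset.Icc 1 n, (1 / (n : ℝ) - (1 - α) * p i) * M := by
      refine Finset.sum_le_sum fun i hi => ?_
      have hi' := Finset.mem_Icc.mp hi
      refine mul_le_mul_of_nonneg_left (Finset.le_sup' l hi) ?_
      have := mul_le_mul_of_nonneg_left (hmono 1 i le_rfl hi'.1 hi'.2) (sub_nonneg.mpr hα2)
      linarith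
    have hleft : ∑ i ∈ Finset.Icc 1 n, (1 / (n : ℝ) - (1 - α) * p i) * l i =
        1 / n * ∑ i ∈ Finset.Icc 1 n, l i - (1 - α) * ∑ i ∈ Finset.Icc 1 n, p i * l i := by
      simp only [sub_mul, Finset.sum_sub_distrib, Finset.mul_sum, mul_assoc]
    have hright : ∑ i ∈ Finset.Icc 1 n, (1 / (n : ℝ) - (1 - α) * p i) * M = α * M := by
      rw [← Finset.sum_mul, Finset.sum_sub_distrib, ← Finset.mul_sum, hsum, Finset.sum_const,
        Nat.card_Icc, nsmul_eq_mul, Nat.add_sub_cancel, mul_one_div_cancel hn0.ne']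
      ring
    have hmean : Real.logb D n ≤ 1 / n * ∑ i ∈ Finset.Icc 1 n, l i := by
      have h := card_mul_logb_le_sum_of_kraft (Finset.Icc 1 n)
        (by exact_mod_cast (by omega : 1 < D) : (1 : ℝ) < D) l hK
      rw [Nat.card_Icc, Nat.add_sub_cancel] at h
      rw [one_div, inv_mul_eq_div, le_div_iff₀ hn0]
      linarith
    linarith
  · have h1 : n - (n - 1) = 1 := by omega
    rw [wgt, h1, if_neg (by omega), hsum, Nat.cast_sub (by omega : 1 ≤ n)]
    simp
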